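/- Let (U_i, 𝔅_i), i = 1,…,N, be measurable spaces whose σ-algebras contain all singletons, with each U_i nonempty, and let A, B : U = U_1 × ⋯ × U_N → ℝ be measurable functions such that A and B are integrable with respect to every product μ_1 × ⋯ × μ_N of probability measures μ_i on U_i and B is strictly of constant sign on U. If the test function C(u) = A(u)/B(u) is bounded below on U, then the infimum of the linear-fractional integral functional I over all families (μ_1,…,μ_N) of probability measures equals the infimum of C over U: inf over all families of I(μ_1,…,μ_N) = inf over families of Dirac measures of I = inf_{u ∈ U} A(u)/B(u). -/

import Mathlib

open MeasureTheory

theorem le_integral_div_integral {Ω : Type*} [MeasurableSpace Ω] {ν : Measure Ω}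
    [IsProbabilityMeasure ν] {f g : Ω → ℝ} (hf : Integrable f ν) (hg : Integrable g ν)
    (hpos : ∀ x, 0 < g x) {c : ℝ} (hc : ∀ x, c ≤ f x / g x) :
    c ≤ (∫ x, f x ∂ν) / (∫ x, g x ∂ν) := by
  have hg_int : 0 < ∫ x, g x ∂ν := by
    rw [integral_pos_iff_support_of_nonneg (fun x => (hpos x).le) hg,
      Function.support_eq_univ fun x => (hpos x).ne']
    simp
  rw [le_div_iff₀ hg_int, ← integral_const_mul]
  exact integral_mono (hg.const_mul c) hf fun x => (le_div_iff₀ (hpos x)).1 (hc x)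

theorem le_integral_div_integral_of_constant_sign {Ω : Type*} [MeasurableSpace Ω]
    {ν : Measure Ω} [IsProbabilityMeasure ν] {f g : Ω → ℝ} (hf : Integrable f ν)
    (hg : Integrable g ν) (hsign : (∀ x, 0 < g x) ∨ (∀ x, g x < 0)) {c : ℝ}
    (hc : ∀ x, c ≤ f x / g x) :
    c ≤ (∫ x, f x ∂ν) / (∫ x, g x ∂ν) := by
  rcases hsign with hpos | hneg
  · exact le_integral_div_integral hf hg hpos hc
  · have h := le_integral_div_integral hf.neg hg.neg (c := c)
      (fun x => neg_pos.2 (hneg x)) (fun x => by simpa [neg_div_neg_eq] using hc x)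
    simpa [integral_neg, neg_div_neg_eq] using h

theorem pi_dirac_eq_dirac {ι : Type*} [Fintype ι] {X : ι → Type*}
    [∀ i, MeasurableSpace (X i)] (w : ∀ i, X i) :
    (Measure.pi fun i => Measure.dirac (w i)) = Measure.dirac w := by
  classical
  refine Measure.pi_eq fun s hs => ?_
  rw [Measure.dirac_apply' _ (MeasurableSet.univ_pi hs)]
  simp only [Measure.dirac_apply' _ (hs _), Set.indicator_apply, Set.mem_univ_pi, Pi.one_apply]
  by_cases h : ∀ i, w i ∈ s i
  · simp [h]
  · rw [if_neg h]
    push Not at h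
    obtain ⟨i, hi⟩ := h
    exact (Finset.prod_eq_zero (Finset.mem_univ i) (if_neg hi)).symm

/-- If the test function `C = A/B` is bounded below on `U` (nonempty), then the infimum of the
linear-fractional integral functional over all families of probability measures equals its
infimum over families of Dirac measures, and both equal `inf_{u ∈ U} A(u)/B(u)`. -/
theorem stmt_12 {N : ℕ} {U : Fin N → Type*} [∀ i, MeasurableSpace (U i)]
    [∀ i, MeasurableSingletonClass (U i)] [∀ i, Nonempty (U i)]
    (A B : ((i : Fin N) → U i) → ℝ)
    (hAm : Measurable A) (hBm : Measurable B)
    (hA : ∀ μ : ∀ i, Measure (U i), (∀ i, IsProbabilityMeasure (μ i)) →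
      Integrable A (Measure.pi μ))
    (hB : ∀ μ : ∀ i, Measure (U i), (∀ i, IsProbabilityMeasure (μ i)) →
      Integrable B (Measure.pi μ))
    (hBsign : (∀ u, 0 < B u) ∨ (∀ u, B u < 0))
    (hbdd : BddBelow (Set.range fun u => A u / B u)) :
    sInf {r : ℝ | ∃ μ : ∀ i, Measure (U i), (∀ i, IsProbabilityMeasure (μ i)) ∧
        r = (∫ u, A u ∂Measure.pi μ) / (∫ u, B u ∂Measure.pi μ)} = (⨅ u, A u / B u) ∧
    sInf {r : ℝ | ∃ w : (i : Fin N) → U i,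
        r = (∫ v, A v ∂Measure.pi fun i => Measure.dirac (w i)) /
          (∫ v, B v ∂Measure.pi fun i => Measure.dirac (w i))} = (⨅ u, A u / B u) := by
  have hdirac (w : (i : Fin N) → U i) :
      (∫ v, A v ∂Measure.pi fun i => Measure.dirac (w i)) /
        (∫ v, B v ∂Measure.pi fun i => Measure.dirac (w i)) = A w / B w := by
    rw [pi_dirac_eq_dirac, integral_dirac' A w hAm.stronglyMeasurable,
      integral_dirac' B w hBm.stronglyMeasurable]
  constructor
  · have hlower : ∀ r ∈ {r : ℝ | ∃ μ : ∀ i, Measure (U i),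
        (∀ i, IsProbabilityMeasure (μ i)) ∧
          r = (∫ u, A u ∂Measure.pi μ) / (∫ u, B u ∂Measure.pi μ)},
        (⨅ u, A u / B u) ≤ r := by
      rintro r ⟨μ, hμ, rfl⟩
      exact le_integral_div_integral_of_constant_sign (hA μ hμ) (hB μ hμ) hBsign
        fun u => ciInf_le hbdd u
    refine le_antisymm (le_ciInf fun w => csInf_le ⟨_, hlower⟩ ?_) (le_csInf ?_ hlower)
    · exact ⟨fun i => Measure.dirac (w i), fun i => inferInstance, (hdirac w).symm⟩
    · exact ⟨_, fun i => Measure.dirac (Classical.arbitrary (U i)), fun i => inferInstance, rfl⟩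
  · simp only [hdirac, iInf, Set.range, eq_comm]
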